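/- Let (s_a) be nonnegative integers indexed by the atoms a of T0, with S := ∑_a s_a satisfying 1 ≤ S ≤ n0 − 1, and let β = (n0 − 1 − S)/n0. Then for every integer t ≥ 0: β^t · ∏_a C(n^{(a)}(T0), s_a) ≤ ∑_T K^t(T0, T) · ∏_a C(n^{(a)}(T), s_a) ≤ β^t · (n0/(1+S)) · ∏_a C(n^{(a)}(T0), s_a), where the sum runs over all rooted subtrees T of T0, K^t denotes the t-th matrix power, and C(m,s) is a binomial coefficient, equal to 0 if s > m. -/

import Mathlib

open scoped Classical

noncomputable section

/-- A rooted subtree of the finite rooted-tree poset `V`: a nonempty lower set,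
recorded as a `Finset`. -/
abbrev RSub (V : Type) [PartialOrder V] : Type :=
  {T : Finset V // T.Nonempty ∧ ∀ ⦃a b : V⦄, a ≤ b → b ∈ T → a ∈ T}

/-- `linExt T` : the number of linear extensions of the sub-poset `T`, i.e. of
order-preserving bijections from `T` (with the induced order) to the chain
`{1 < 2 < … < |T|}`. -/
def linExt {V : Type} [PartialOrder V] (T : Finset V) : ℕ :=
  Nat.card {φ : {x // x ∈ T} ≃ Fin T.card //
    ∀ a b : {x // x ∈ T}, (a : V) ≤ (b : V) → (φ a : ℕ) ≤ (φ b : ℕ)}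

/-- The transition matrix of the single-model employee-firing chain on the rooted
subtrees of `V`:  from a state `T` with at least two elements, stay put with probability
`(n₀ - |T|)/n₀`, and move to `T \ {v}` (for `v` a maximal element of `T`) with
probability `(|T|/n₀) ⬝ ℓ(T\{v})/ℓ(T)`;  the singleton root is absorbing. -/
def Kfire {V : Type} [Fintype V] [PartialOrder V] (T T' : RSub V) : ℝ :=
  if 2 ≤ T.1.card then
    if T' = T then ((Fintype.card V : ℝ) - (T.1.card : ℝ)) / (Fintype.card V : ℝ)
    else if ∃ v ∈ T.1, (∀ w ∈ T.1, v ≤ w → w = v) ∧ T'.1 = T.1.erase v then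
      ((T.1.card : ℝ) / (Fintype.card V : ℝ)) * (linExt T'.1 : ℝ) / (linExt T.1 : ℝ)
    else 0
  else if T' = T then 1 else 0

/-- `Kfire` as a square matrix indexed by the rooted subtrees of `V`. -/
def KfireM (V : Type) [Fintype V] [PartialOrder V] : Matrix (RSub V) (RSub V) ℝ :=
  Matrix.of fun T T' => Kfire T T'


/-- The maximal elements of a finite subset of a poset. -/
def maxElems {V : Type} [PartialOrder V] (T : Finset V) : Finset V :=
  T.filter fun v => ∀ w ∈ T, v ≤ w → w = v

lemma mem_maxElems {V : Type} [PartialOrder V] {T : Finset V} {v : V} :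
    v ∈ maxElems T ↔ v ∈ T ∧ ∀ w ∈ T, v ≤ w → w = v := by
  simp [maxElems]

/-- The linear extensions of `T`, written as lists in decreasing order. -/
def linExtLists {V : Type} [PartialOrder V] (T : Finset V) : Set (List V) :=
  {l | (∀ x, x ∈ l ↔ x ∈ T) ∧ l.Pairwise fun a b => ¬ a ≤ b}

lemma nodup_of_mem_linExtLists {V : Type} [PartialOrder V] {T : Finset V} {l : List V}
    (hl : l ∈ linExtLists T) : l.Nodup :=
  hl.2.imp fun h hab => h hab.le

lemma length_of_mem_linExtLists {V : Type} [PartialOrder V] {T : Finset V} {l : List V}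
    (hl : l ∈ linExtLists T) : l.length = T.card := by
  rw [← List.toFinset_card_of_nodup (nodup_of_mem_linExtLists hl)]
  congr 1
  ext x
  simp [hl.1 x]

lemma linExt_eq_ncard {V : Type} [PartialOrder V] (T : Finset V) :
    linExt T = (linExtLists T).ncard := by
  unfold linExt
  rw [← Nat.card_coe_set_eq]
  let F : {φ : {x // x ∈ T} ≃ Fin T.card //
      ∀ a b : {x // x ∈ T}, (a : V) ≤ (b : V) → (φ a : ℕ) ≤ (φ b : ℕ)} → linExtLists T :=
    fun φ => ⟨List.ofFn fun i => (φ.1.symm (Fin.rev i) : V), by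
      refine ⟨fun x => ?_, ?_⟩
      · rw [List.mem_ofFn]
        refine ⟨?_, fun hx => ⟨Fin.rev (φ.1 ⟨x, hx⟩), by simp⟩⟩
        rintro ⟨i, rfl⟩
        exact Subtype.prop _
      · rw [List.pairwise_ofFn]
        intro i j hij hle
        have h := φ.2 _ _ hle
        simp only [Equiv.apply_symm_apply, Fin.val_rev] at h
        have := j.2
        have := Fin.lt_def.1 hij
        omega⟩
  refine Nat.card_congr (Equiv.ofBijective F ⟨?_, ?_⟩)
  · intro φ ψ h
    have h1 := List.ofFn_injective (Subtype.ext_iff.1 h)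
    refine Subtype.ext (Equiv.symm_bijective.1 (Equiv.ext fun i => Subtype.ext ?_))
    simpa using congrFun h1 (Fin.rev i)
  · rintro ⟨l, hl⟩
    have hlen := length_of_mem_linExtLists hl
    have hnd := nodup_of_mem_linExtLists hl
    let e : Fin T.card → {x // x ∈ T} := fun i =>
      ⟨l.get (Fin.cast hlen.symm (Fin.rev i)), (hl.1 _).1 (List.get_mem _ _)⟩
    have he : Function.Bijective e := by
      rw [Fintype.bijective_iff_injective_and_card]
      refine ⟨fun i j hij => ?_, by simp⟩
      have := List.nodup_iff_injective_get.1 hnd (Subtype.ext_iff.1 hij)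
      exact Fin.rev_injective (Fin.cast_injective _ this)
    refine ⟨⟨(Equiv.ofBijective e he).symm, fun x y hxy => ?_⟩, ?_⟩
    · obtain ⟨i, rfl⟩ := he.2 x
      obtain ⟨j, rfl⟩ := he.2 y
      rw [Equiv.ofBijective_symm_apply_apply, Equiv.ofBijective_symm_apply_apply]
      by_contra! hlt
      have := List.pairwise_iff_get.1 hl.2 (Fin.cast hlen.symm (Fin.rev i))
        (Fin.cast hlen.symm (Fin.rev j)) (by
          rw [Fin.lt_def]
          simp only [Fin.val_cast, Fin.val_rev]
          have := i.2
          omega)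
      exact this hxy
    · refine Subtype.ext ?_
      refine List.ext_get (by simp [F, hlen]) fun n h1 h2 => ?_
      simp only [F, e, Equiv.symm_symm, List.get_eq_getElem, List.getElem_ofFn,
        Equiv.ofBijective_apply, Fin.val_cast, Fin.rev_rev]

lemma linExtLists_eq_biUnion {V : Type} [PartialOrder V] {T : Finset V} (hT : T.Nonempty) :
    linExtLists T = ⋃ v ∈ maxElems T, List.cons v '' linExtLists (T.erase v) := by
  ext l
  simp only [Set.mem_iUnion, Set.mem_image, exists_prop]
  constructor
  · intro hl
    rcases l with _ | ⟨v, l⟩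
    · obtain ⟨x, hx⟩ := hT
      simpa using (hl.1 x).2 hx
    have hnd := nodup_of_mem_linExtLists hl
    have hp := List.pairwise_cons.1 hl.2
    refine ⟨v, mem_maxElems.2 ⟨(hl.1 v).1 (by simp), fun w hw hvw => ?_⟩, l, ⟨fun x => ?_, hp.2⟩, rfl⟩
    · rcases List.mem_cons.1 ((hl.1 w).2 hw) with h | h
      · exact h
      · exact absurd hvw (hp.1 w h)
    · rw [Finset.mem_erase, ← hl.1 x, List.mem_cons]
      have := (List.nodup_cons.1 hnd).1
      grind
  · rintro ⟨v, hv, l, hl, rfl⟩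
    rw [mem_maxElems] at hv
    refine ⟨fun x => ?_, List.pairwise_cons.2 ⟨fun w hw hvw => ?_, hl.2⟩⟩
    · rw [List.mem_cons, hl.1 x, Finset.mem_erase]
      grind
    · have := Finset.mem_erase.1 ((hl.1 w).1 hw)
      exact this.1 (hv.2 w this.2 hvw)

lemma finite_linExtLists {V : Type} [PartialOrder V] (T : Finset V) :
    (linExtLists T).Finite := by
  refine (List.finite_toSet T.toList.permutations).subset fun l hl => ?_
  rw [Set.mem_ofPred_eq, List.mem_permutations]
  refine (List.perm_ext_iff_of_nodup (nodup_of_mem_linExtLists hl) T.nodup_toList).2 fun x => ?_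
  simp [hl.1 x]

lemma linExt_eq_sum {V : Type} [PartialOrder V] {T : Finset V} (hT : T.Nonempty) :
    linExt T = ∑ v ∈ maxElems T, linExt (T.erase v) := by
  have hdisj : (maxElems T : Set V).PairwiseDisjoint
      fun v => List.cons v '' linExtLists (T.erase v) := by
    intro v _ w _ hvw
    rw [Function.onFun, Set.disjoint_left]
    rintro _ ⟨l, _, rfl⟩ ⟨l', _, h⟩
    exact hvw (List.cons.inj h).1.symm
  have h := Set.Finite.ncard_biUnion (Finset.finite_toSet (maxElems T))
    (fun v _ => (finite_linExtLists (T.erase v)).image (List.cons v)) hdisj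
  rw [finsum_mem_coe_finset] at h
  rw [linExt_eq_ncard, linExtLists_eq_biUnion hT]
  refine h.trans (Finset.sum_congr rfl fun v _ => ?_)
  rw [Set.ncard_image_of_injective _ List.cons_injective, linExt_eq_ncard]

lemma exists_mem_maxElems {V : Type} [PartialOrder V] {T : Finset V} (hT : T.Nonempty) :
    ∃ v, v ∈ maxElems T := by
  obtain ⟨v, hv⟩ := T.exists_maximal hT
  exact ⟨v, mem_maxElems.2 ⟨hv.1, fun w hw hvw => le_antisymm (hv.2 hw hvw) hvw⟩⟩

lemma linExt_pos {V : Type} [PartialOrder V] (T : Finset V) : 0 < linExt T := by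
  induction T using Finset.strongInduction with
  | H T ih =>
    rcases T.eq_empty_or_nonempty with rfl | hT
    · rw [linExt_eq_ncard, Set.ncard_pos (finite_linExtLists _)]
      exact ⟨[], by simp [linExtLists]⟩
    · rw [linExt_eq_sum hT]
      exact Finset.sum_pos
        (fun v hv => ih _ (Finset.erase_ssubset (mem_maxElems.1 hv).1)) (exists_mem_maxElems hT)

lemma isLowerSet_erase {V : Type} [PartialOrder V] {T : Finset V}
    (hT : ∀ ⦃a b : V⦄, a ≤ b → b ∈ T → a ∈ T) {v : V} (hv : v ∈ maxElems T) :
    ∀ ⦃a b : V⦄, a ≤ b → b ∈ T.erase v → a ∈ T.erase v := by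
  intro a b hab hb
  rw [Finset.mem_erase] at hb ⊢
  refine ⟨?_, hT hab hb.2⟩
  rintro rfl
  exact hb.1 ((mem_maxElems.1 hv).2 b hb.2 hab)

lemma bot_notMem_maxElems {V : Type} [PartialOrder V] [OrderBot V] {T : Finset V}
    (hcard : 2 ≤ T.card) : (⊥ : V) ∉ maxElems T := by
  intro h
  rw [mem_maxElems] at h
  have : T ⊆ {⊥} := fun w hw => Finset.mem_singleton.2 (h.2 w hw bot_le)
  have := Finset.card_le_card this
  simp at this
  omega

lemma card_filter_erase_real {V : Type} [PartialOrder V] {T : Finset V} (a : V) {v : V}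
    (hv : v ∈ T) :
    (((T.erase v).filter (fun w => a ≤ w)).card : ℝ) =
      ((T.filter (fun w => a ≤ w)).card : ℝ) - if a ≤ v then 1 else 0 := by
  rw [Finset.filter_erase]
  split_ifs with h
  · rw [Finset.cast_card_erase_of_mem (by simp [hv, h])]
  · rw [Finset.erase_eq_of_notMem (by simp [h]), sub_zero]

lemma maxElems_exchange {V : Type} [PartialOrder V] [OrderBot V]
    (htree : ∀ v a b : V, a ≤ v → b ≤ v → a ≤ b ∨ b ≤ a) {a : V} (ha : IsAtom a)
    {T : Finset V} (hcard : 3 ≤ T.card) (v w : V) :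
    (v ∈ (maxElems T).filter (fun v => a ≤ v) ∧
        w ∈ (maxElems (T.erase v)).filter (fun w => ¬ a ≤ w)) ↔
      (v ∈ (maxElems (T.erase w)).filter (fun v => a ≤ v) ∧
        w ∈ (maxElems T).filter (fun w => ¬ a ≤ w)) := by
  simp only [Finset.mem_filter]
  constructor
  · rintro ⟨⟨hv, hav⟩, hw, haw⟩
    have hw0 : w ≠ ⊥ := by
      rintro rfl
      refine bot_notMem_maxElems ?_ hw
      rw [Finset.card_erase_of_mem (mem_maxElems.1 hv).1]
      omega
    have hwv : ¬ w ≤ v := fun hwv => by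
      rcases htree v a w hav hwv with h | h
      · exact haw h
      · rcases ha.le_iff.1 h with h | h
        · exact hw0 h
        · exact haw h.ge
    simp only [mem_maxElems, Finset.mem_erase] at hv hw ⊢
    grind
  · rintro ⟨⟨hv, hav⟩, hw, haw⟩
    have hvw : ¬ v ≤ w := fun h => haw (hav.trans h)
    simp only [mem_maxElems, Finset.mem_erase] at hv hw ⊢
    grind

/-- In a uniformly random linear extension of a rooted tree with `n` elements, the last element
lies above a given atom with probability proportional to the number of elements above it. -/
lemma sum_linExt_erase_above_atom {V : Type} [PartialOrder V] [OrderBot V]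
    (htree : ∀ v a b : V, a ≤ v → b ≤ v → a ≤ b ∨ b ≤ a) {a : V} (ha : IsAtom a)
    (n : ℕ) : ∀ T : Finset V, T.card = n + 2 → (∀ ⦃a b : V⦄, a ≤ b → b ∈ T → a ∈ T) →
      ((n : ℝ) + 1) * ∑ v ∈ (maxElems T).filter (fun v => a ≤ v), (linExt (T.erase v) : ℝ) =
        ((T.filter (fun w => a ≤ w)).card : ℝ) * linExt T := by
  have ha0 : ¬ a ≤ ⊥ := fun h => ha.1 (le_bot_iff.1 h)
  have hrec : ∀ T : Finset V, T.Nonempty → (linExt T : ℝ) =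
      ∑ v ∈ (maxElems T).filter (fun v => a ≤ v), (linExt (T.erase v) : ℝ) +
      ∑ v ∈ (maxElems T).filter (fun v => ¬ a ≤ v), (linExt (T.erase v) : ℝ) := by
    intro T hT
    rw [Finset.sum_filter_add_sum_filter_not, linExt_eq_sum hT, Nat.cast_sum]
  induction n with
  | zero =>
    intro T hcard hT
    have hne : T.Nonempty := Finset.card_pos.1 (by omega)
    have hbot : ⊥ ∈ T := hT bot_le hne.choose_spec
    obtain ⟨x, hx⟩ := Finset.card_eq_one.1 (show (T.erase ⊥).card = 1 by
      rw [Finset.card_erase_of_mem hbot, hcard])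
    have hx' : ∀ y, y ∈ T ∧ y ≠ ⊥ ↔ y = x := fun y => by
      rw [← Finset.mem_singleton, ← hx, Finset.mem_erase, and_comm]
    have hmax : maxElems T = {x} := by
      obtain ⟨v, hv⟩ := exists_mem_maxElems hne
      have h0 := bot_notMem_maxElems (T := T) (by omega)
      have hsub : maxElems T ⊆ {x} := fun y hy => Finset.mem_singleton.2
        ((hx' y).1 ⟨(mem_maxElems.1 hy).1, fun h => h0 (h ▸ hy)⟩)
      have := Finset.mem_singleton.1 (hsub hv)
      subst this
      exact Finset.Subset.antisymm hsub (by simpa using hv)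
    have hfil : T.filter (fun w => a ≤ w) = ({x} : Finset V).filter (fun w => a ≤ w) := by
      ext y
      simp only [Finset.mem_filter, Finset.mem_singleton, ← hx' y]
      grind
    rw [hrec T hne, hmax, hfil, Finset.filter_singleton, Finset.filter_singleton]
    by_cases h : a ≤ x <;> simp [h]
  | succ n ih =>
    intro T hcard hT
    have hne : T.Nonempty := Finset.card_pos.1 (by omega)
    have key : ∀ v ∈ maxElems T, ((n : ℝ) + 1) *
        ∑ w ∈ (maxElems (T.erase v)).filter (fun w => a ≤ w), (linExt ((T.erase v).erase w) : ℝ) =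
        (((T.filter (fun w => a ≤ w)).card : ℝ) - if a ≤ v then 1 else 0) *
          linExt (T.erase v) := by
      intro v hv
      rw [ih _ (by rw [Finset.card_erase_of_mem (mem_maxElems.1 hv).1]; omega)
        (isLowerSet_erase hT hv), card_filter_erase_real a (mem_maxElems.1 hv).1]
    have hsum := Finset.sum_congr rfl key
    simp only [sub_mul, Finset.sum_sub_distrib, ← Finset.mul_sum, ite_mul, one_mul, zero_mul,
      ← Finset.sum_filter] at hsum
    rw [← Nat.cast_sum, ← linExt_eq_sum hne,
      ← Finset.sum_filter_add_sum_filter_not (maxElems T) (fun v => a ≤ v)] at hsum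
    have hex : ∑ v ∈ (maxElems T).filter (fun v => ¬ a ≤ v),
          ∑ w ∈ (maxElems (T.erase v)).filter (fun w => a ≤ w), (linExt ((T.erase v).erase w) : ℝ) =
        ∑ v ∈ (maxElems T).filter (fun v => a ≤ v),
          ∑ w ∈ (maxElems (T.erase v)).filter (fun w => ¬ a ≤ w),
            (linExt ((T.erase v).erase w) : ℝ) := by
      symm
      rw [Finset.sum_comm' (maxElems_exchange htree ha (by omega))]
      refine Finset.sum_congr rfl fun v _ => Finset.sum_congr rfl fun w _ => ?_
      rw [Finset.erase_right_comm]
    rw [hex, ← Finset.sum_add_distrib, ← Finset.sum_congr rfl fun v hv => hrec (T.erase v) ?_]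
      at hsum
    · push_cast
      linarith
    · refine Finset.card_pos.1 ?_
      rw [Finset.card_erase_of_mem (mem_maxElems.1 (Finset.mem_filter.1 hv).1).1]
      omega

/-- The product of binomial coefficients counting teams with `s a` members in branch `a`. -/
def teams {V : Type} [Fintype V] [PartialOrder V] [OrderBot V] (s : V → ℕ) (T : Finset V) : ℝ :=
  ∏ a ∈ Finset.univ.filter (fun a : V => IsAtom a),
    ((T.filter (fun w => a ≤ w)).card.choose (s a) : ℝ)

lemma teams_nonneg {V : Type} [Fintype V] [PartialOrder V] [OrderBot V] (s : V → ℕ)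
    (T : Finset V) : 0 ≤ teams s T :=
  Finset.prod_nonneg fun _ _ => Nat.cast_nonneg _

lemma choose_div_mul_self (m k : ℕ) :
    (m.choose k : ℝ) * ((k : ℝ) / m * m) = (m.choose k : ℝ) * k := by
  rcases Nat.eq_zero_or_pos m with rfl | hm
  · rcases Nat.eq_zero_or_pos k with rfl | hk
    · simp
    · simp [Nat.choose_eq_zero_of_lt hk]
  · rw [div_mul_cancel₀ _ (by positivity)]

lemma choose_pred_eq {m : ℕ} (hm : 0 < m) (k : ℕ) :
    ((m - 1).choose k : ℝ) = (m.choose k : ℝ) * (1 - (k : ℝ) / m) := by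
  obtain ⟨m, rfl⟩ := Nat.exists_eq_add_of_lt hm
  simp only [zero_add, Nat.add_sub_cancel]
  rcases lt_or_ge (m + 1) k with hk | hk
  · simp [Nat.choose_eq_zero_of_lt hk, Nat.choose_eq_zero_of_lt (show m < k by omega)]
  · have h : (m.choose k : ℝ) * (m + 1) = ((m + 1).choose k : ℝ) * (m + 1 - k) := by
      have := congrArg (Nat.cast (R := ℝ)) (Nat.choose_mul_succ_eq m k)
      push_cast [Nat.cast_sub hk] at this
      exact this
    have : (m : ℝ) + 1 ≠ 0 := by positivity
    push_cast
    field_simp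
    linarith

lemma exists_unique_atom_le {V : Type} [Fintype V] [PartialOrder V] [OrderBot V]
    (htree : ∀ v a b : V, a ≤ v → b ≤ v → a ≤ b ∨ b ≤ a) {v : V} (hv : v ≠ ⊥) :
    ∃ b, IsAtom b ∧ ∀ a, IsAtom a → (a ≤ v ↔ a = b) := by
  obtain ⟨b, hb, hbv⟩ := (eq_bot_or_exists_atom_le v).resolve_left hv
  refine ⟨b, hb, fun a ha => ⟨fun hav => ?_, fun h => h ▸ hbv⟩⟩
  rcases htree v a b hav hbv with h | h
  · exact (hb.le_iff.1 h).resolve_left ha.1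
  · exact ((ha.le_iff.1 h).resolve_left hb.1).symm

lemma teams_erase {V : Type} [Fintype V] [PartialOrder V] [OrderBot V]
    (htree : ∀ v a b : V, a ≤ v → b ≤ v → a ≤ b ∨ b ≤ a) (s : V → ℕ) {T : Finset V} {v : V}
    (hvT : v ∈ T) (hv : v ≠ ⊥) :
    teams s (T.erase v) = teams s T * (1 - ∑ a ∈ Finset.univ.filter (fun a : V => IsAtom a),
      if a ≤ v then (s a : ℝ) / ((T.filter (fun w => a ≤ w)).card : ℝ) else 0) := by
  obtain ⟨b, hb, hab⟩ := exists_unique_atom_le htree hv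
  have hbv : b ≤ v := (hab b hb).2 rfl
  have hbmem : b ∈ Finset.univ.filter (fun a : V => IsAtom a) := by simpa using hb
  have hsum : (∑ a ∈ Finset.univ.filter (fun a : V => IsAtom a),
      if a ≤ v then (s a : ℝ) / ((T.filter (fun w => a ≤ w)).card : ℝ) else 0) =
      (s b : ℝ) / ((T.filter (fun w => b ≤ w)).card : ℝ) := by
    rw [Finset.sum_eq_single_of_mem b hbmem, if_pos hbv]
    intro a ha hne
    rw [if_neg fun h => hne ((hab a (Finset.mem_filter.1 ha).2).1 h)]
  have hpos : 0 < (T.filter (fun w => b ≤ w)).card :=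
    Finset.card_pos.2 ⟨v, by simp [hvT, hbv]⟩
  rw [hsum, teams, teams, ← Finset.mul_prod_erase _ _ hbmem, ← Finset.mul_prod_erase _ _ hbmem,
    Finset.filter_erase, Finset.card_erase_of_mem (by simp [hvT, hbv]), choose_pred_eq hpos,
    mul_right_comm]
  congr 2
  refine Finset.prod_congr rfl fun a ha => ?_
  have ha' := Finset.mem_erase.1 ha
  rw [Finset.filter_erase, Finset.erase_eq_of_notMem]
  simp only [Finset.mem_filter, not_and]
  exact fun _ h => ha'.1 ((hab a (Finset.mem_filter.1 ha'.2).2).1 h)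

lemma sum_linExt_mul_teams {V : Type} [Fintype V] [PartialOrder V] [OrderBot V]
    (htree : ∀ v a b : V, a ≤ v → b ≤ v → a ≤ b ∨ b ≤ a) (s : V → ℕ) {T : Finset V}
    (hT : ∀ ⦃a b : V⦄, a ≤ b → b ∈ T → a ∈ T) (hcard : 2 ≤ T.card) :
    ((T.card : ℝ) - 1) * ∑ v ∈ maxElems T, (linExt (T.erase v) : ℝ) * teams s (T.erase v) =
      linExt T * teams s T * ((T.card : ℝ) - 1 -
        ((∑ a ∈ Finset.univ.filter (fun a : V => IsAtom a), s a : ℕ) : ℝ)) := by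
  obtain ⟨n, hn⟩ := Nat.exists_eq_add_of_le' hcard
  have hne : T.Nonempty := Finset.card_pos.1 (by omega)
  have h1 : ∑ v ∈ maxElems T, (linExt (T.erase v) : ℝ) * teams s (T.erase v) =
      teams s T * (linExt T - ∑ a ∈ Finset.univ.filter (fun a : V => IsAtom a),
        (s a : ℝ) / ((T.filter (fun w => a ≤ w)).card : ℝ) *
          ∑ v ∈ (maxElems T).filter (fun v => a ≤ v), (linExt (T.erase v) : ℝ)) := by
    rw [linExt_eq_sum hne, Nat.cast_sum]
    simp_rw [Finset.sum_filter (s := maxElems T), Finset.mul_sum]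
    rw [Finset.sum_comm, ← Finset.sum_sub_distrib, Finset.mul_sum]
    refine Finset.sum_congr rfl fun v hv => ?_
    rw [teams_erase htree s (mem_maxElems.1 hv).1
      (ne_of_mem_of_not_mem hv (bot_notMem_maxElems hcard)), mul_left_comm, mul_sub, mul_one,
      Finset.mul_sum]
    congr 2
    refine Finset.sum_congr rfl fun a _ => ?_
    split_ifs
    · rw [mul_comm]
    · simp
  have hcast : (T.card : ℝ) - 1 = n + 1 := by
    rw [hn]; push_cast; ring
  rw [h1, hcast, mul_left_comm, mul_sub, Finset.mul_sum, mul_sub, Finset.mul_sum]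
  have h2 : ∀ a ∈ Finset.univ.filter (fun a : V => IsAtom a),
      teams s T * (((n : ℝ) + 1) * ((s a : ℝ) / ((T.filter (fun w => a ≤ w)).card : ℝ) *
          ∑ v ∈ (maxElems T).filter (fun v => a ≤ v), (linExt (T.erase v) : ℝ))) =
      teams s T * linExt T * s a := by
    intro a ha
    rw [mul_left_comm ((n : ℝ) + 1), sum_linExt_erase_above_atom htree (Finset.mem_filter.1 ha).2
      n T hn hT, teams, ← Finset.mul_prod_erase _ _ ha]
    linear_combination (linExt T : ℝ) * (∏ x ∈ (Finset.univ.filter fun a : V => IsAtom a).erase a,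
      ((T.filter (fun w => x ≤ w)).card.choose (s x) : ℝ)) *
      choose_div_mul_self (T.filter (fun w => a ≤ w)).card (s a)
  rw [Finset.sum_congr rfl h2, ← Finset.mul_sum]
  push_cast
  ring

lemma erase_mem_RSub {V : Type} [PartialOrder V] {T : RSub V} (hcard : 2 ≤ T.1.card) {v : V}
    (hv : v ∈ maxElems T.1) :
    (T.1.erase v).Nonempty ∧ ∀ ⦃a b : V⦄, a ≤ b → b ∈ T.1.erase v → a ∈ T.1.erase v := by
  refine ⟨Finset.card_pos.1 ?_, isLowerSet_erase T.2.2 hv⟩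
  rw [Finset.card_erase_of_mem (mem_maxElems.1 hv).1]
  omega

lemma Kfire_eq_add_sum {V : Type} [Fintype V] [PartialOrder V] {T : RSub V}
    (hcard : 2 ≤ T.1.card) (T' : RSub V) :
    Kfire T T' = (if T' = T then ((Fintype.card V : ℝ) - T.1.card) / Fintype.card V else 0) +
      ∑ v ∈ maxElems T.1, if T'.1 = T.1.erase v then
        ((T.1.card : ℝ) / Fintype.card V) * (linExt (T.1.erase v) : ℝ) / (linExt T.1 : ℝ)
        else 0 := by
  have hmem : ∀ v ∈ maxElems T.1, v ∈ T.1 := fun v hv => (mem_maxElems.1 hv).1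
  rw [Kfire, if_pos hcard]
  split_ifs with h h'
  · subst h
    rw [Finset.sum_eq_zero, add_zero]
    intro v hv
    refine if_neg fun h => Finset.notMem_erase v T'.1 ?_
    rw [← h]
    exact hmem v hv
  · obtain ⟨v, hv, hmax, hT'⟩ := h'
    have hvm : v ∈ maxElems T.1 := mem_maxElems.2 ⟨hv, hmax⟩
    rw [zero_add, Finset.sum_eq_single_of_mem v hvm, if_pos hT', hT']
    intro w hw hne
    refine if_neg fun h => ?_
    have : w ∈ T.1.erase v := Finset.mem_erase.2 ⟨hne, hmem w hw⟩
    rw [← hT', h] at this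
    exact Finset.notMem_erase _ _ this
  · rw [Finset.sum_eq_zero, add_zero]
    intro v hv
    exact if_neg fun h => h' ⟨v, hmem v hv, (mem_maxElems.1 hv).2, h⟩

lemma sum_Kfire_mul {V : Type} [Fintype V] [PartialOrder V] {T : RSub V}
    (hcard : 2 ≤ T.1.card) (F : Finset V → ℝ) :
    ∑ T' : RSub V, Kfire T T' * F T'.1 =
      ((Fintype.card V : ℝ) - T.1.card) / Fintype.card V * F T.1 +
      ∑ v ∈ maxElems T.1, ((T.1.card : ℝ) / Fintype.card V) * (linExt (T.1.erase v) : ℝ) /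
        (linExt T.1 : ℝ) * F (T.1.erase v) := by
  simp_rw [Kfire_eq_add_sum hcard, add_mul, Finset.sum_mul, Finset.sum_add_distrib]
  rw [Finset.sum_comm]
  congr 1
  · simp
  · refine Finset.sum_congr rfl fun v hv => ?_
    rw [Finset.sum_eq_single ⟨T.1.erase v, erase_mem_RSub hcard hv⟩]
    · rw [if_pos rfl]
    · intro T' _ hne
      rw [if_neg fun h => hne (Subtype.ext h), zero_mul]
    · simp

lemma sum_teams_card_le {V : Type} [Fintype V] [PartialOrder V] [OrderBot V]
    (htree : ∀ v a b : V, a ≤ v → b ≤ v → a ≤ b ∨ b ≤ a) (s : V → ℕ) {T : RSub V}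
    (h : teams s T.1 ≠ 0) :
    1 + ∑ a ∈ Finset.univ.filter (fun a : V => IsAtom a), s a ≤ T.1.card := by
  obtain ⟨x, hx⟩ := T.2.1
  have hbot : ⊥ ∈ T.1 := T.2.2 bot_le hx
  have hle : ∑ a ∈ Finset.univ.filter (fun a : V => IsAtom a), s a ≤
      ∑ a ∈ Finset.univ.filter (fun a : V => IsAtom a), (T.1.filter (fun w => a ≤ w)).card := by
    refine Finset.sum_le_sum fun a ha => ?_
    by_contra! hlt
    refine h (Finset.prod_eq_zero ha ?_)
    rw [Nat.choose_eq_zero_of_lt hlt, Nat.cast_zero]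
  have hdisj : ((Finset.univ.filter (fun a : V => IsAtom a) : Finset V) : Set V).PairwiseDisjoint
      (fun a => T.1.filter (fun w => a ≤ w)) := by
    intro a ha b hb hab
    rw [Function.onFun, Finset.disjoint_left]
    intro w hwa hwb
    have ha' : IsAtom a := by simpa using ha
    have hb' : IsAtom b := by simpa using hb
    have hw1 := (Finset.mem_filter.1 hwa).2
    have hw2 := (Finset.mem_filter.1 hwb).2
    obtain ⟨c, -, hc⟩ := exists_unique_atom_le htree (v := w)
      (fun h => ha'.1 (le_bot_iff.1 (h ▸ hw1)))
    exact hab (((hc a ha').1 hw1).trans ((hc b hb').1 hw2).symm)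
  rw [← Finset.card_biUnion hdisj] at hle
  have hsub : (Finset.univ.filter (fun a : V => IsAtom a)).biUnion
      (fun a => T.1.filter (fun w => a ≤ w)) ⊆ T.1.erase ⊥ := by
    intro w hw
    obtain ⟨a, ha, hw⟩ := Finset.mem_biUnion.1 hw
    have hw := Finset.mem_filter.1 hw
    refine Finset.mem_erase.2 ⟨?_, hw.1⟩
    rintro rfl
    exact (Finset.mem_filter.1 ha).2.1 (le_bot_iff.1 hw.2)
  have hc := Finset.card_le_card hsub
  rw [Finset.card_erase_of_mem hbot] at hc
  have := Finset.card_pos.2 T.2.1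
  omega

/-- The function `T ↦ |T| * teams s T` is an eigenfunction of the firing chain. -/
lemma sum_Kfire_mul_card_mul_teams {V : Type} [Fintype V] [PartialOrder V] [OrderBot V]
    (htree : ∀ v a b : V, a ≤ v → b ≤ v → a ≤ b ∨ b ≤ a) (s : V → ℕ)
    (hS : 1 ≤ ∑ a ∈ Finset.univ.filter (fun a : V => IsAtom a), s a) (T : RSub V) :
    ∑ T' : RSub V, Kfire T T' * ((T'.1.card : ℝ) * teams s T'.1) =
      ((Fintype.card V : ℝ) - 1 -
        ((∑ a ∈ Finset.univ.filter (fun a : V => IsAtom a), s a : ℕ) : ℝ)) /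
          (Fintype.card V : ℝ) * ((T.1.card : ℝ) * teams s T.1) := by
  have hV : (Fintype.card V : ℝ) ≠ 0 := Nat.cast_ne_zero.2 Fintype.card_ne_zero
  by_cases hcard : 2 ≤ T.1.card
  · have hl : (linExt T.1 : ℝ) ≠ 0 := Nat.cast_ne_zero.2 (linExt_pos _).ne'
    have hsum : ∑ v ∈ maxElems T.1, ((T.1.card : ℝ) / Fintype.card V) *
        (linExt (T.1.erase v) : ℝ) / (linExt T.1 : ℝ) *
          (((T.1.erase v).card : ℝ) * teams s (T.1.erase v)) =
        (T.1.card : ℝ) / Fintype.card V / linExt T.1 * (((T.1.card : ℝ) - 1) *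
          ∑ v ∈ maxElems T.1, (linExt (T.1.erase v) : ℝ) * teams s (T.1.erase v)) := by
      rw [Finset.mul_sum, Finset.mul_sum]
      refine Finset.sum_congr rfl fun v hv => ?_
      rw [Finset.cast_card_erase_of_mem (mem_maxElems.1 hv).1]
      ring
    rw [sum_Kfire_mul hcard (fun A => (A.card : ℝ) * teams s A), hsum,
      sum_linExt_mul_teams htree s T.2.2 hcard]
    field_simp
    ring
  · have h0 : teams s T.1 = 0 := by
      by_contra h
      have := sum_teams_card_le htree s h
      omega
    rw [h0, mul_zero, mul_zero]
    refine Finset.sum_eq_zero fun T' _ => ?_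
    rw [Kfire, if_neg hcard]
    split_ifs with h
    · rw [h, h0, mul_zero, mul_zero]
    · rw [zero_mul]

lemma Kfire_nonneg {V : Type} [Fintype V] [PartialOrder V] (T T' : RSub V) : 0 ≤ Kfire T T' := by
  have : (T.1.card : ℝ) ≤ Fintype.card V := by exact_mod_cast Finset.card_le_univ T.1
  have := sub_nonneg.2 this
  unfold Kfire
  split_ifs <;> positivity

lemma KfireM_pow_nonneg {V : Type} [Fintype V] [PartialOrder V] (t : ℕ) (T T' : RSub V) :
    0 ≤ (KfireM V ^ t) T T' := by
  induction t generalizing T' with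
  | zero =>
    rw [pow_zero, Matrix.one_apply]
    split_ifs <;> norm_num
  | succ t ih =>
    rw [pow_succ, Matrix.mul_apply]
    exact Finset.sum_nonneg fun U _ => mul_nonneg (ih U) (Kfire_nonneg U T')

lemma sum_KfireM_pow_mul_card_mul_teams {V : Type} [Fintype V] [PartialOrder V] [OrderBot V]
    (htree : ∀ v a b : V, a ≤ v → b ≤ v → a ≤ b ∨ b ≤ a) (s : V → ℕ)
    (hS : 1 ≤ ∑ a ∈ Finset.univ.filter (fun a : V => IsAtom a), s a) (t : ℕ) (T : RSub V) :
    ∑ T' : RSub V, (KfireM V ^ t) T T' * ((T'.1.card : ℝ) * teams s T'.1) =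
      (((Fintype.card V : ℝ) - 1 -
        ((∑ a ∈ Finset.univ.filter (fun a : V => IsAtom a), s a : ℕ) : ℝ)) /
          (Fintype.card V : ℝ)) ^ t * ((T.1.card : ℝ) * teams s T.1) := by
  induction t with
  | zero => simp [Matrix.one_apply]
  | succ t ih =>
    simp_rw [pow_succ (KfireM V), Matrix.mul_apply, Finset.sum_mul]
    rw [Finset.sum_comm]
    simp_rw [mul_assoc, ← Finset.mul_sum]
    have h : ∀ U : RSub V, ∑ T' : RSub V, KfireM V U T' * ((T'.1.card : ℝ) * teams s T'.1) = _ :=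
      fun U => sum_Kfire_mul_card_mul_teams htree s hS U
    simp_rw [h, mul_left_comm _ (((Fintype.card V : ℝ) - 1 -
        ((∑ a ∈ Finset.univ.filter (fun a : V => IsAtom a), s a : ℕ) : ℝ)) /
          (Fintype.card V : ℝ)), ← Finset.mul_sum]
    rw [ih, pow_succ]
    ring

/-- **Expected number of inter-departmental teams after `t` firings.**  With `(s a)`
nonnegative integers indexed by the atoms `a` of `V`, `S = ∑ s a` (`1 ≤ S ≤ n₀ - 1`),
`β = (n₀ - 1 - S)/n₀`, and the chain started at the full tree `T₀ = V`:
`β^t ⬝ ∏_a C(n⁽ᵃ⁾(T₀), s a) ≤ E[∏_a C(n⁽ᵃ⁾(T_t), s a)] ≤ β^t ⬝ (n₀/(1+S)) ⬝ ∏_a C(n⁽ᵃ⁾(T₀), s a)`. -/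
theorem firing_chain_expected_teams_bounds
    (V : Type) [Fintype V] [PartialOrder V] [OrderBot V]
    (htree : ∀ v a b : V, a ≤ v → b ≤ v → a ≤ b ∨ b ≤ a)
    (s : V → ℕ)
    (hS1 : 1 ≤ ∑ a ∈ Finset.univ.filter (fun a : V => IsAtom a), s a)
    (hS2 : (∑ a ∈ Finset.univ.filter (fun a : V => IsAtom a), s a) ≤ Fintype.card V - 1)
    (t : ℕ) :
    ((((Fintype.card V : ℝ) - 1 -
          ((∑ a ∈ Finset.univ.filter (fun a : V => IsAtom a), s a : ℕ) : ℝ)) /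
        (Fintype.card V : ℝ)) ^ t *
      ∏ a ∈ Finset.univ.filter (fun a : V => IsAtom a),
        (((Finset.univ : Finset V).filter (fun w => a ≤ w)).card.choose (s a) : ℝ)
      ≤ ∑ T : RSub V,
          (KfireM V ^ t)
            ⟨Finset.univ, ⟨⊥, Finset.mem_univ ⊥⟩, fun a b _ _ => Finset.mem_univ a⟩ T *
          ∏ a ∈ Finset.univ.filter (fun a : V => IsAtom a),
            ((T.1.filter (fun w => a ≤ w)).card.choose (s a) : ℝ)) ∧
    (∑ T : RSub V,
          (KfireM V ^ t)
            ⟨Finset.univ, ⟨⊥, Finset.mem_univ ⊥⟩, fun a b _ _ => Finset.mem_univ a⟩ T *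
          ∏ a ∈ Finset.univ.filter (fun a : V => IsAtom a),
            ((T.1.filter (fun w => a ≤ w)).card.choose (s a) : ℝ)
      ≤ (((Fintype.card V : ℝ) - 1 -
            ((∑ a ∈ Finset.univ.filter (fun a : V => IsAtom a), s a : ℕ) : ℝ)) /
          (Fintype.card V : ℝ)) ^ t *
        ((Fintype.card V : ℝ) /
          (1 + ((∑ a ∈ Finset.univ.filter (fun a : V => IsAtom a), s a : ℕ) : ℝ))) *
        ∏ a ∈ Finset.univ.filter (fun a : V => IsAtom a),
          (((Finset.univ : Finset V).filter (fun w => a ≤ w)).card.choose (s a) : ℝ)) := by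
  have hpos : (0 : ℝ) < Fintype.card V := Nat.cast_pos.2 Fintype.card_pos
  set R : RSub V := ⟨Finset.univ, ⟨⊥, Finset.mem_univ ⊥⟩, fun a b _ _ => Finset.mem_univ a⟩
  set S : ℕ := ∑ a ∈ Finset.univ.filter (fun a : V => IsAtom a), s a with hS
  have heig := sum_KfireM_pow_mul_card_mul_teams htree s hS1 t R
  rw [← hS] at heig
  have hRcard : (R.1.card : ℝ) = Fintype.card V := rfl
  rw [hRcard] at heig
  change _ * teams s R.1 ≤ ∑ T : RSub V, (KfireM V ^ t) R T * teams s T.1 ∧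
    ∑ T : RSub V, (KfireM V ^ t) R T * teams s T.1 ≤ _ * teams s R.1
  have hS0 : (0 : ℝ) < 1 + S := by positivity
  constructor
  · refine le_of_mul_le_mul_left ?_ hpos
    rw [mul_left_comm, ← heig, Finset.mul_sum]
    refine Finset.sum_le_sum fun T _ => ?_
    rw [mul_left_comm (Fintype.card V : ℝ)]
    refine mul_le_mul_of_nonneg_left (mul_le_mul_of_nonneg_right ?_ (teams_nonneg s _))
      (KfireM_pow_nonneg t R T)
    exact_mod_cast Finset.card_le_univ T.1
  · refine le_of_mul_le_mul_left ?_ hS0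
    have hrw : (1 + (S : ℝ)) * ((((Fintype.card V : ℝ) - 1 - S) / Fintype.card V) ^ t *
        ((Fintype.card V : ℝ) / (1 + S)) * teams s R.1) =
        (((Fintype.card V : ℝ) - 1 - S) / Fintype.card V) ^ t *
          ((Fintype.card V : ℝ) * teams s R.1) := by
      rw [mul_assoc, mul_left_comm, ← mul_assoc (1 + (S : ℝ)), mul_div_cancel₀ _ hS0.ne']
    rw [hrw, ← heig, Finset.mul_sum]
    refine Finset.sum_le_sum fun T _ => ?_
    rw [mul_left_comm]
    refine mul_le_mul_of_nonneg_left ?_ (KfireM_pow_nonneg t R T)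
    by_cases h : teams s T.1 = 0
    · rw [h, mul_zero, mul_zero]
    · refine mul_le_mul_of_nonneg_right ?_ (teams_nonneg s _)
      exact_mod_cast sum_teams_card_le htree s h

end
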